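/- Let γ_{2,2,2} be the permutation of {1,…,7} whose one-line notation is 7, 6, 4, 3, 5, 2, 1. Then for all n ≥ 5, |S_n(132, 123, γ_{2,2,2})| = 5·F_{n+1} − 9n + 21, where F_m denotes the m-th Fibonacci number. -/

import Mathlib

/-- `π` contains `σ` as a pattern: there is a subsequence of `π` (in one-line notation)
whose entries are in the same relative order as those of `σ`. -/
def PContains {n k : ℕ} (π : Equiv.Perm (Fin n)) (σ : Equiv.Perm (Fin k)) : Prop :=
  ∃ f : Fin k → Fin n, StrictMono f ∧ ∀ s t : Fin k, π (f s) < π (f t) ↔ σ s < σ t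

/-- `π` avoids the pattern `σ`. -/
def PAvoids {n k : ℕ} (π : Equiv.Perm (Fin n)) (σ : Equiv.Perm (Fin k)) : Prop :=
  ¬ PContains π σ

/-- The pattern 123 (the identity permutation of `{1,2,3}`). -/
def p123 : Equiv.Perm (Fin 3) := Equiv.refl (Fin 3)

/-- The pattern 132 (one-line notation `1,3,2`, zero-indexed `0,2,1`). -/
noncomputable def p132 : Equiv.Perm (Fin 3) := Equiv.ofBijective ![0, 2, 1] (by decide)

/-- The pattern `γ_{2,2,2}` with one-line notation `7,6,4,3,5,2,1`
(zero-indexed `6,5,3,2,4,1,0`). -/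
noncomputable def g222 : Equiv.Perm (Fin 7) :=
  Equiv.ofBijective ![6, 5, 3, 2, 4, 1, 0] (by decide)

/-- Every entry of `π` has at most one larger entry to its right. -/
def AtMostOneLarger {n : ℕ} (π : Equiv.Perm (Fin n)) : Prop :=
  ∀ i j k, i < j → i < k → π i < π j → π i < π k → j = k

/-- The entry of `π` at position `i` has a larger entry to its right. -/
def HasLarger {n : ℕ} (π : Equiv.Perm (Fin n)) (i : ℕ) : Prop :=
  ∃ h : i < n, ∃ j : Fin n, i < j ∧ π ⟨i, h⟩ < π j

theorem atMostOneLarger_iff {n : ℕ} (π : Equiv.Perm (Fin n)) :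
    AtMostOneLarger π ↔ PAvoids π p132 ∧ PAvoids π p123 := by
  constructor
  · intro h
    constructor
    · rintro ⟨f, hf, hp⟩
      have h1 := hf (show (0 : Fin 3) < 1 by decide)
      have h2 := hf (show (1 : Fin 3) < 2 by decide)
      exact h2.ne (h (f 0) (f 1) (f 2) h1 (h1.trans h2)
        ((hp 0 1).2 (by simp [p132])) ((hp 0 2).2 (by simp [p132])))
    · rintro ⟨f, hf, hp⟩
      have h1 := hf (show (0 : Fin 3) < 1 by decide)
      have h2 := hf (show (1 : Fin 3) < 2 by decide)
      exact h2.ne (h (f 0) (f 1) (f 2) h1 (h1.trans h2)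
        ((hp 0 1).2 (by simp [p123])) ((hp 0 2).2 (by simp [p123])))
  · rintro ⟨h132, h123⟩
    have key : ∀ i j k, i < j → j < k → π i < π j → π i < π k → False := by
      intro i j k hij hjk h1 h2
      have hmono : StrictMono ![i, j, k] := by
        rw [Fin.strictMono_iff_lt_succ]
        intro s
        fin_cases s
        · exact hij
        · exact hjk
      rcases lt_or_gt_of_ne (π.injective.ne hjk.ne) with h3 | h3
      · refine h123 ⟨_, hmono, fun s t => ?_⟩
        fin_cases s <;> fin_cases t <;> simp [p123, h1, h2, h3, h1.le, h2.le, h3.le]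
      · refine h132 ⟨_, hmono, fun s t => ?_⟩
        fin_cases s <;> fin_cases t <;> simp [p132, h1, h2, h3, h1.le, h2.le, h3.le]
    intro i j k hij hik h1 h2
    rcases lt_trichotomy j k with h | h | h
    · exact (key i j k hij h h1 h2).elim
    · exact h
    · exact (key i k j hik h h2 h1).elim

theorem AtMostOneLarger.lt_iff {n : ℕ} {π : Equiv.Perm (Fin n)} (hπ : AtMostOneLarger π)
    {i j : Fin n} (hij : i < j) :
    π i < π j ↔ (∀ k : ℕ, i ≤ k → k < j → HasLarger π k) ∧ ¬ HasLarger π j := by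
  constructor
  · intro h
    constructor
    · intro k hik hkj
      have hk : k < n := hkj.trans j.2
      refine ⟨hk, j, hkj, ?_⟩
      rcases hik.eq_or_lt with rfl | hik
      · exact h
      · by_contra hc
        have hne : (⟨k, hk⟩ : Fin n) ≠ j := fun e => by simp [← e] at hkj
        refine hne (hπ i ⟨k, hk⟩ j hik hij ?_ h)
        exact h.trans_le (not_lt.1 hc)
    · rintro ⟨hj, l, hjl, hl⟩
      have hjl' : j < l := hjl
      exact hjl'.ne (hπ i j l hij (hij.trans hjl') h (h.trans hl))
  · rintro ⟨hones, hzero⟩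
    have key : ∀ d : ℕ, ∀ i : Fin n, i < j → (j : ℕ) - i = d →
        (∀ k : ℕ, i ≤ k → k < j → HasLarger π k) → π i < π j := by
      intro d
      induction d using Nat.strong_induction_on with
      | _ d ih =>
        intro i hij hd hones
        obtain ⟨_, l, hil, hl⟩ := hones i le_rfl hij
        rcases lt_trichotomy l j with h | rfl | h
        · have h1 : (i : ℕ) < l := hil
          have h2 : (l : ℕ) < j := h
          exact hl.trans (ih (j - l) (by omega) l h rfl
            fun k hk hkj => hones k (h1.le.trans hk) hkj)
        · exact hl
        · have : π l < π j := by
            by_contra hc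
            exact hzero ⟨j.2, l, h, lt_of_le_of_ne (not_lt.1 hc) (π.injective.ne h.ne)⟩
          exact hl.trans this
    exact key _ i hij rfl hones

theorem AtMostOneLarger.gt_iff {n : ℕ} {π : Equiv.Perm (Fin n)} (hπ : AtMostOneLarger π)
    {i j : Fin n} (hij : i < j) :
    π j < π i ↔ (∃ k : ℕ, i ≤ k ∧ k < j ∧ ¬ HasLarger π k) ∨ HasLarger π j := by
  have h1 : π j < π i ↔ ¬ π i < π j :=
    ⟨fun h => h.asymm, fun h => lt_of_le_of_ne (not_lt.1 h) (π.injective.ne hij.ne')⟩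
  rw [h1, hπ.lt_iff hij, not_and_or]
  push Not
  rfl

/-- In a word `b` of length `n` whose last letter is `0`, the factor `110` occurs at position `e`
and the letters following it are none of the words `ε`, `0`, `10`. -/
def Trigger (n : ℕ) (b : ℕ → Prop) (e : ℕ) : Prop :=
  b e ∧ b (e + 1) ∧ ¬ b (e + 2) ∧ (e + 6 ≤ n ∨ (e + 5 = n ∧ ¬ b (e + 3)))

/-- The words `b` of length `n` encoding the permutations that contain `g222`. -/
def Bad (n : ℕ) (b : ℕ → Prop) : Prop :=
  ∃ z, ¬ b z ∧ (2 ≤ z ∨ (z = 1 ∧ ¬ b 0)) ∧ ∃ e, z < e ∧ Trigger n b e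

theorem g222_apply (s : Fin 7) : g222 s = ![6, 5, 3, 2, 4, 1, 0] s := by
  simp [g222]

theorem AtMostOneLarger.pContains_g222_iff {n : ℕ} {π : Equiv.Perm (Fin n)}
    (hπ : AtMostOneLarger π) : PContains π g222 ↔ Bad n (HasLarger π) := by
  constructor
  · rintro ⟨f, hf, hp⟩
    have h01 : f 0 < f 1 := hf (by decide)
    have h12 : f 1 < f 2 := hf (by decide)
    have h23 : f 2 < f 3 := hf (by decide)
    have h34 : f 3 < f 4 := hf (by decide)
    have h45 : f 4 < f 5 := hf (by decide)
    have h56 : f 5 < f 6 := hf (by decide)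
    have p24 := (hπ.lt_iff (h23.trans h34)).1 ((hp 2 4).2 (by simp [g222_apply]))
    have p14 := (hπ.gt_iff (h12.trans (h23.trans h34))).1 ((hp 4 1).2 (by simp [g222_apply]))
    have p01 := (hπ.gt_iff h01).1 ((hp 1 0).2 (by simp [g222_apply]))
    have p56 := (hπ.gt_iff h56).1 ((hp 6 5).2 (by simp [g222_apply]))
    have hlast : ¬ HasLarger π (n - 1) := by
      rintro ⟨_, j, hj, _⟩
      omega
    rw [Fin.lt_def] at h01 h12 h23 h34 h45 h56
    have h6 := (f 6).2
    obtain ⟨ones, zero⟩ := p24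
    obtain ⟨z, hz1, hz2, hz⟩ := p14.resolve_right zero
    have hz3 : z < f 2 := by
      by_contra hc
      exact hz (ones z (by omega) hz2)
    refine ⟨z, hz, ?_, f 4 - 2, by omega, ones _ (by omega) (by omega),
      ones _ (by omega) (by omega), ?_, ?_⟩
    · by_cases h2 : 2 ≤ z
      · exact Or.inl h2
      · have e0 : (f 0 : ℕ) = 0 := by omega
        have e1 : (f 1 : ℕ) = 1 := by omega
        have ez : z = 1 := by omega
        subst ez
        refine Or.inr ⟨rfl, ?_⟩
        rw [e0, e1] at p01
        obtain ⟨k, -, hk, hk'⟩ := p01.resolve_right hz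
        obtain rfl : k = 0 := by omega
        exact hk'
    · rwa [show (f 4 : ℕ) - 2 + 2 = f 4 by omega]
    · by_cases h3 : (f 4 : ℕ) - 2 + 6 ≤ n
      · exact Or.inl h3
      · refine Or.inr ⟨by omega, ?_⟩
        have e6 : (f 6 : ℕ) = n - 1 := by omega
        rw [e6] at p56
        obtain ⟨k, hk1, hk2, hk⟩ := p56.resolve_right hlast
        rwa [show (f 4 : ℕ) - 2 + 3 = k by omega]
  · rintro ⟨z, hz, hpre, e, hze, he0, he1, he2, hsuf⟩
    obtain ⟨p, q, hpq, hqz, hdec⟩ : ∃ p q : ℕ, p < q ∧ q ≤ z ∧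
        (¬ HasLarger π p ∨ HasLarger π q) := by
      by_cases h : HasLarger π (z - 1)
      · rcases hpre with h2 | ⟨rfl, h0⟩
        · exact ⟨z - 2, z - 1, by omega, by omega, Or.inr h⟩
        · exact (h0 h).elim
      · exact ⟨z - 1, z, by omega, le_rfl, Or.inl h⟩
    obtain ⟨r, s, her, hrs, hsn, hdec'⟩ : ∃ r s : ℕ, e + 2 < r ∧ r < s ∧ s < n ∧
        (¬ HasLarger π r ∨ HasLarger π s) := by
      by_cases h : HasLarger π (e + 3)
      · have h6 : e + 6 ≤ n := hsuf.resolve_right fun h' => h'.2 h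
        by_cases h' : HasLarger π (e + 4)
        · exact ⟨e + 3, e + 4, by omega, by omega, by omega, Or.inr h'⟩
        · exact ⟨e + 4, e + 5, by omega, by omega, by omega, Or.inl h'⟩
      · exact ⟨e + 3, e + 4, by omega, by omega, by omega, Or.inl h⟩
    have descent : ∀ {i j : ℕ} (hij : i < j) (hj : j < n),
        ((∃ k : ℕ, i ≤ k ∧ k < j ∧ ¬ HasLarger π k) ∨ HasLarger π j) →
        π ⟨j, hj⟩ < π ⟨i, hij.trans hj⟩ := fun hij hj h => (hπ.gt_iff hij).2 h
    have c1 : π ⟨q, by omega⟩ < π ⟨p, by omega⟩ := descent hpq (by omega)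
      (hdec.imp (fun h => ⟨p, le_rfl, hpq, h⟩) id)
    have c2 : π ⟨e + 2, by omega⟩ < π ⟨q, by omega⟩ :=
      descent (by omega) (by omega) (Or.inl ⟨z, hqz, by omega, hz⟩)
    have c3 : π ⟨e, by omega⟩ < π ⟨e + 2, by omega⟩ := by
      refine (hπ.lt_iff (by simp)).2 ⟨fun k h1 h2 => ?_, he2⟩
      simp only at h1 h2
      obtain rfl | rfl : k = e ∨ k = e + 1 := by omega
      · exact he0
      · exact he1
    have c4 : π ⟨e + 1, by omega⟩ < π ⟨e, by omega⟩ :=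
      descent (by omega) (by omega) (Or.inr he1)
    have c5 : π ⟨r, by omega⟩ < π ⟨e + 1, by omega⟩ :=
      descent (by omega) (by omega) (Or.inl ⟨e + 2, by omega, her, he2⟩)
    have c6 : π ⟨s, hsn⟩ < π ⟨r, by omega⟩ :=
      descent hrs hsn (hdec'.imp (fun h => ⟨r, le_rfl, hrs, h⟩) id)
    let x : Fin 7 → Fin n := ![⟨p, by omega⟩, ⟨q, by omega⟩, ⟨e, by omega⟩, ⟨e + 1, by omega⟩,
      ⟨e + 2, by omega⟩, ⟨r, by omega⟩, ⟨s, hsn⟩]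
    have hval : StrictMono fun t : Fin 7 => π (x (g222.symm t)) := by
      have hs : ∀ t : Fin 7, g222.symm t = ![6, 5, 3, 2, 4, 1, 0] t := by
        intro t
        rw [Equiv.symm_apply_eq, g222_apply]
        fin_cases t <;> rfl
      simp only [hs]
      rw [Fin.strictMono_iff_lt_succ]
      intro t
      fin_cases t
      · exact c6
      · exact c5
      · exact c4
      · exact c3
      · exact c2
      · exact c1
    refine ⟨x, ?_, fun s t => ?_⟩
    · rw [Fin.strictMono_iff_lt_succ]
      intro t
      fin_cases t <;> simp [x, Fin.lt_def] <;> omega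
    · simpa using hval.lt_iff_lt (a := g222 s) (b := g222 t)

/-- The permutation obtained from `π` by inserting the value `a` at the front. -/
def insertFront {n : ℕ} (a : Fin (n + 1)) (π : Equiv.Perm (Fin n)) : Equiv.Perm (Fin (n + 1)) :=
  (finSuccEquiv' 0).trans ((Equiv.optionCongr π).trans (finSuccEquiv' a).symm)

@[simp]
theorem insertFront_zero {n : ℕ} (a : Fin (n + 1)) (π : Equiv.Perm (Fin n)) :
    insertFront a π 0 = a := by
  simp [insertFront]

@[simp]
theorem insertFront_succ {n : ℕ} (a : Fin (n + 1)) (π : Equiv.Perm (Fin n)) (i : Fin n) :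
    insertFront a π i.succ = a.succAbove (π i) := by
  simp [insertFront, finSuccEquiv'_zero]

theorem insertFront_inj {n : ℕ} {a b : Fin (n + 1)} {π ρ : Equiv.Perm (Fin n)}
    (h : insertFront a π = insertFront b ρ) : a = b ∧ π = ρ := by
  have hab : a = b := by simpa using DFunLike.congr_fun h 0
  subst hab
  refine ⟨rfl, Equiv.ext fun i => ?_⟩
  simpa using DFunLike.congr_fun h i.succ

theorem exists_insertFront {n : ℕ} (π : Equiv.Perm (Fin (n + 1))) :
    ∃ ρ, π = insertFront (π 0) ρ := by
  let σ : Option (Fin n) ≃ Option (Fin n) :=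
    (finSuccEquiv' 0).symm.trans (π.trans (finSuccEquiv' (π 0)))
  have hσ : σ none = none := by simp [σ]
  refine ⟨Equiv.removeNone σ, Equiv.ext fun i => ?_⟩
  have h : Equiv.optionCongr (Equiv.removeNone σ) = σ := by
    rw [map_equiv_removeNone, hσ, Equiv.swap_self]
    rfl
  simp [insertFront, h, σ]

theorem atMostOneLarger_insertFront {n : ℕ} {a : Fin (n + 1)} {π : Equiv.Perm (Fin n)} :
    AtMostOneLarger (insertFront a π) ↔ n ≤ a + 1 ∧ AtMostOneLarger π := by
  constructor
  · intro h
    constructor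
    · by_contra hc
      have pos : ∀ v : Fin (n + 1), a < v → 0 < (insertFront a π).symm v := by
        intro v hv
        rw [Fin.pos_iff_ne_zero]
        intro h0
        rw [Equiv.symm_apply_eq, insertFront_zero] at h0
        exact hv.ne h0.symm
      have h1 : a < ⟨n, by omega⟩ := by rw [Fin.lt_def]; simp only; omega
      have h2 : a < ⟨n - 1, by omega⟩ := by rw [Fin.lt_def]; simp only; omega
      have := h 0 _ _ (pos _ h1) (pos _ h2) (by simpa using h1) (by simpa using h2)
      have := Fin.val_eq_of_eq ((insertFront a π).symm.injective this)
      simp only at this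
      omega
    · intro i j k hij hik h1 h2
      have := h i.succ j.succ k.succ (by simpa) (by simpa) (by simpa) (by simpa)
      simpa using this
  · rintro ⟨ha, h⟩ i j k hij hik h1 h2
    obtain ⟨j, rfl⟩ := Fin.exists_succ_eq.2 (Fin.ne_zero_of_lt hij)
    obtain ⟨k, rfl⟩ := Fin.exists_succ_eq.2 (Fin.ne_zero_of_lt hik)
    induction i using Fin.cases with
    | zero =>
      apply (insertFront a π).injective
      rw [insertFront_zero] at h1 h2
      rw [Fin.ext_iff]
      rw [Fin.lt_def] at h1 h2
      omega
    | succ i =>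
      rw [h i j k (by simpa using hij) (by simpa using hik) (by simpa using h1)
        (by simpa using h2)]

/-- Prepend a letter to an infinite word. -/
def consWord (x : Prop) (b : ℕ → Prop) : ℕ → Prop
  | 0 => x
  | i + 1 => b i

@[simp]
theorem consWord_zero (x : Prop) (b : ℕ → Prop) : consWord x b 0 = x := rfl

@[simp]
theorem consWord_succ (x : Prop) (b : ℕ → Prop) (i : ℕ) : consWord x b (i + 1) = b i := rfl

theorem hasLarger_insertFront {n : ℕ} (a : Fin (n + 1)) (π : Equiv.Perm (Fin n)) :
    HasLarger (insertFront a π) = consWord (a < Fin.last n) (HasLarger π) := by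
  funext i
  apply propext
  cases i with
  | zero =>
    constructor
    · rintro ⟨_, j, _, hj⟩
      exact lt_of_lt_of_le (by simpa using hj) (Fin.le_last _)
    · intro h
      refine ⟨n.succ_pos, (insertFront a π).symm (Fin.last n), ?_, by simpa using h⟩
      apply Nat.pos_of_ne_zero
      intro h0
      have h0' : (insertFront a π).symm (Fin.last n) = 0 := Fin.ext h0
      rw [Equiv.symm_apply_eq, insertFront_zero] at h0'
      exact h.ne h0'.symm
  | succ i =>
    constructor
    · rintro ⟨hi, j, hij, hj⟩
      obtain ⟨j, rfl⟩ := Fin.exists_succ_eq.2 (show j ≠ 0 by rintro rfl; simp at hij)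
      refine ⟨by omega, j, by simpa using hij, ?_⟩
      rwa [show (⟨i + 1, hi⟩ : Fin (n + 1)) = Fin.succ ⟨i, by omega⟩ from rfl, insertFront_succ,
        insertFront_succ, Fin.succAbove_lt_succAbove_iff] at hj
    · rintro ⟨hi, j, hij, hj⟩
      refine ⟨by omega, j.succ, by simpa using hij, ?_⟩
      rwa [show (⟨i + 1, by omega⟩ : Fin (n + 1)) = Fin.succ ⟨i, hi⟩ from rfl, insertFront_succ,
        insertFront_succ, Fin.succAbove_lt_succAbove_iff]

/-- The number of permutations of `Fin n` avoiding 132 and 123 whose word satisfies `P`. -/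
noncomputable def wordCount (n : ℕ) (P : (ℕ → Prop) → Prop) : ℕ :=
  Nat.card {π : Equiv.Perm (Fin n) // AtMostOneLarger π ∧ P (HasLarger π)}

theorem wordCount_one (P : (ℕ → Prop) → Prop) (h : ∀ b, P b) : wordCount 1 P = 1 := by
  have : Nonempty {π : Equiv.Perm (Fin 1) // AtMostOneLarger π ∧ P (HasLarger π)} :=
    ⟨1, fun _ _ _ _ _ _ _ => Subsingleton.elim _ _, h _⟩
  exact Nat.card_unique

theorem wordCount_eq_zero (n : ℕ) (P : (ℕ → Prop) → Prop) (h : ∀ b, ¬ P b) :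
    wordCount n P = 0 := by
  have : IsEmpty {π : Equiv.Perm (Fin n) // AtMostOneLarger π ∧ P (HasLarger π)} :=
    ⟨fun π => h _ π.2.2⟩
  exact Nat.card_of_isEmpty

theorem wordCount_succ {n : ℕ} (hn : 1 ≤ n) (P : (ℕ → Prop) → Prop) :
    wordCount (n + 1) P =
      wordCount n (fun b => P (consWord False b)) + wordCount n (fun b => P (consWord True b)) := by
  let c : Fin (n + 1) := ⟨n - 1, by omega⟩
  have hc : c < Fin.last n := by
    rw [Fin.lt_def]
    simp only [c, Fin.val_last]
    omega
  have w0 : ∀ π : Equiv.Perm (Fin n),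
      HasLarger (insertFront (Fin.last n) π) = consWord False (HasLarger π) := by
    intro π
    simp [hasLarger_insertFront]
  have w1 : ∀ π : Equiv.Perm (Fin n),
      HasLarger (insertFront c π) = consWord True (HasLarger π) := by
    intro π
    simp [hasLarger_insertFront, hc]
  unfold wordCount
  rw [← Nat.card_sum]
  symm
  refine Nat.card_eq_of_bijective (Sum.elim
    (fun π => ⟨insertFront (Fin.last n) π.1,
      atMostOneLarger_insertFront.2 ⟨by simp, π.2.1⟩, by rw [w0]; exact π.2.2⟩)
    (fun π => ⟨insertFront c π.1,
      atMostOneLarger_insertFront.2 ⟨by simp only [c]; omega, π.2.1⟩,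
      by rw [w1]; exact π.2.2⟩)) ⟨?_, ?_⟩
  · rintro (⟨π, _⟩ | ⟨π, _⟩) (⟨ρ, _⟩ | ⟨ρ, _⟩) h
    all_goals
      have h' := insertFront_inj (Subtype.ext_iff.1 h)
    · simpa using h'.2
    · exact (hc.ne h'.1.symm).elim
    · exact (hc.ne h'.1).elim
    · simpa using h'.2
  · rintro ⟨π, hπ, hP⟩
    obtain ⟨ρ, hρ⟩ := exists_insertFront π
    generalize π 0 = a at hρ
    subst hρ
    obtain ⟨ha, hA⟩ := atMostOneLarger_insertFront.1 hπ
    obtain rfl | rfl : a = Fin.last n ∨ a = c := by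
      rw [Fin.ext_iff, Fin.ext_iff]
      simp only [c, Fin.val_last]
      omega
    · exact ⟨Sum.inl ⟨ρ, hA, by rwa [w0] at hP⟩, rfl⟩
    · exact ⟨Sum.inr ⟨ρ, hA, by rwa [w1] at hP⟩, rfl⟩

theorem trigger_consWord_succ (n : ℕ) (x : Prop) (b : ℕ → Prop) (e : ℕ) :
    Trigger (n + 1) (consWord x b) (e + 1) ↔ Trigger n b e := by
  have h1 : e + 1 + 6 ≤ n + 1 ↔ e + 6 ≤ n := by omega
  have h2 : e + 1 + 5 = n + 1 ↔ e + 5 = n := by omega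
  simp only [Trigger, h1, h2, show e + 1 + 1 = (e + 1) + 1 from rfl,
    show e + 1 + 2 = (e + 2) + 1 from rfl, show e + 1 + 3 = (e + 3) + 1 from rfl, consWord_succ]

/-- Some trigger occurs in the word. -/
def HasTrigger (n : ℕ) (b : ℕ → Prop) : Prop := ∃ e, Trigger n b e

/-- Some trigger occurs in the word after a letter `0`. -/
def HasLateTrigger (n : ℕ) (b : ℕ → Prop) : Prop := ∃ z, ¬ b z ∧ ∃ e, z < e ∧ Trigger n b e

theorem hasTrigger_consWord (n : ℕ) (x : Prop) (b : ℕ → Prop) :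
    HasTrigger (n + 1) (consWord x b) ↔ Trigger (n + 1) (consWord x b) 0 ∨ HasTrigger n b := by
  simp only [HasTrigger]
  rw [← Nat.or_exists_add_one]
  simp only [trigger_consWord_succ]

theorem hasTrigger_false (n : ℕ) (b : ℕ → Prop) :
    HasTrigger (n + 1) (consWord False b) ↔ HasTrigger n b := by
  simp [hasTrigger_consWord, Trigger]

theorem hasTrigger_true_false (n : ℕ) (b : ℕ → Prop) :
    HasTrigger (n + 2) (consWord True (consWord False b)) ↔ HasTrigger n b := by
  rw [hasTrigger_consWord, hasTrigger_false]
  simp [Trigger, consWord]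

theorem hasTrigger_true_true_true (n : ℕ) (b : ℕ → Prop) :
    HasTrigger (n + 3) (consWord True (consWord True (consWord True b))) ↔
      HasTrigger (n + 2) (consWord True (consWord True b)) := by
  rw [hasTrigger_consWord]
  simp [Trigger, consWord]

theorem hasTrigger_true_true_false (n : ℕ) (b : ℕ → Prop) :
    HasTrigger (n + 3) (consWord True (consWord True (consWord False b))) ↔
      (3 ≤ n ∨ (n = 2 ∧ ¬ b 0)) := by
  rw [hasTrigger_consWord, hasTrigger_true_false]
  have h : HasTrigger n b → 3 ≤ n := by
    rintro ⟨e, -, -, -, h⟩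
    omega
  have h1 : 6 ≤ n + 3 ↔ 3 ≤ n := by omega
  have h2 : 5 = n + 3 ↔ n = 2 := by omega
  simp only [Trigger, zero_add, h1, h2, consWord, true_and, not_false_eq_true]
  tauto

theorem hasLateTrigger_false (n : ℕ) (b : ℕ → Prop) :
    HasLateTrigger (n + 1) (consWord False b) ↔ HasTrigger n b := by
  constructor
  · rintro ⟨z, -, e, hze, he⟩
    obtain ⟨e, rfl⟩ : ∃ e', e = e' + 1 := ⟨e - 1, by omega⟩
    exact ⟨e, (trigger_consWord_succ ..).1 he⟩
  · rintro ⟨e, he⟩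
    exact ⟨0, id, e + 1, e.succ_pos, (trigger_consWord_succ ..).2 he⟩

theorem hasLateTrigger_true (n : ℕ) (b : ℕ → Prop) :
    HasLateTrigger (n + 1) (consWord True b) ↔ HasLateTrigger n b := by
  constructor
  · rintro ⟨z, hz, e, hze, he⟩
    obtain ⟨z, rfl⟩ : ∃ z', z = z' + 1 :=
      Nat.exists_eq_succ_of_ne_zero (by rintro rfl; exact hz trivial)
    obtain ⟨e, rfl⟩ : ∃ e', e = e' + 1 := ⟨e - 1, by omega⟩
    exact ⟨z, hz, e, by omega, (trigger_consWord_succ ..).1 he⟩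
  · rintro ⟨z, hz, e, hze, he⟩
    exact ⟨z + 1, hz, e + 1, by omega, (trigger_consWord_succ ..).2 he⟩

theorem bad_consWord_consWord (n : ℕ) (x y : Prop) (b : ℕ → Prop) :
    Bad (n + 2) (consWord x (consWord y b)) ↔
      HasLateTrigger n b ∨ (¬ x ∧ ¬ y ∧ HasTrigger n b) := by
  constructor
  · rintro ⟨z, hz, hpre, e, hze, he⟩
    obtain ⟨e, rfl⟩ : ∃ e', e = e' + 2 := ⟨e - 2, by omega⟩
    have he' : Trigger n b e :=
      (trigger_consWord_succ ..).1 ((trigger_consWord_succ (n + 1) x _ (e + 1)).1 he)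
    rcases hpre with h | ⟨rfl, h⟩
    · obtain ⟨z, rfl⟩ : ∃ z', z = z' + 2 := ⟨z - 2, by omega⟩
      exact Or.inl ⟨z, hz, e, by omega, he'⟩
    · exact Or.inr ⟨h, hz, e, he'⟩
  · have lift : ∀ e, Trigger n b e → Trigger (n + 2) (consWord x (consWord y b)) (e + 2) :=
      fun e he => (trigger_consWord_succ (n + 1) x _ (e + 1)).2 ((trigger_consWord_succ ..).2 he)
    rintro (⟨z, hz, e, hze, he⟩ | ⟨hx, hy, e, he⟩)
    · exact ⟨z + 2, hz, Or.inl (by omega), e + 2, by omega, lift e he⟩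
    · exact ⟨1, hy, Or.inr ⟨rfl, hx⟩, e + 2, by omega, lift e he⟩

theorem HasLateTrigger.hasTrigger {n : ℕ} {b : ℕ → Prop} (h : HasLateTrigger n b) :
    HasTrigger n b := by
  obtain ⟨_, _, e, _, he⟩ := h
  exact ⟨e, he⟩

/-- Number of words of length `n` such that prepending `0` creates no trigger. -/
noncomputable def count0 (n : ℕ) : ℕ := wordCount n fun b => ¬ HasTrigger n b

/-- Number of words of length `n` such that prepending `1` creates no trigger. -/
noncomputable def count1 (n : ℕ) : ℕ := wordCount n fun b => ¬ HasTrigger (n + 1) (consWord True b)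

/-- Number of words of length `n` such that prepending `11` creates no trigger. -/
noncomputable def count2 (n : ℕ) : ℕ :=
  wordCount n fun b => ¬ HasTrigger (n + 2) (consWord True (consWord True b))

/-- Number of words of length `n` without a late trigger. -/
noncomputable def countLate (n : ℕ) : ℕ := wordCount n fun b => ¬ HasLateTrigger n b

/-- Number of words of length `n` which create no trigger when put after `110`. -/
noncomputable def countTail (n : ℕ) : ℕ := wordCount n fun b => ¬ (3 ≤ n ∨ (n = 2 ∧ ¬ b 0))

theorem count0_succ {n : ℕ} (hn : 1 ≤ n) : count0 (n + 1) = count0 n + count1 n := by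
  rw [count0, wordCount_succ hn]
  simp only [hasTrigger_false]
  rfl

theorem count1_succ {n : ℕ} (hn : 1 ≤ n) : count1 (n + 1) = count0 n + count2 n := by
  rw [count1, wordCount_succ hn]
  simp only [hasTrigger_true_false]
  rfl

theorem count2_succ {n : ℕ} (hn : 1 ≤ n) : count2 (n + 1) = countTail n + count2 n := by
  rw [count2, wordCount_succ hn]
  simp only [hasTrigger_true_true_false, hasTrigger_true_true_true]
  rfl

theorem countLate_succ {n : ℕ} (hn : 1 ≤ n) : countLate (n + 1) = count0 n + countLate n := by
  rw [countLate, wordCount_succ hn]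
  simp only [hasLateTrigger_false, hasLateTrigger_true]
  rfl

theorem wordCount_bad {n : ℕ} (hn : 1 ≤ n) :
    wordCount (n + 2) (fun b => ¬ Bad (n + 2) b) = count0 n + 3 * countLate n := by
  rw [wordCount_succ (by omega), wordCount_succ hn, wordCount_succ hn]
  have h : ∀ b, HasLateTrigger n b ∨ HasTrigger n b ↔ HasTrigger n b :=
    fun b => or_iff_right_of_imp HasLateTrigger.hasTrigger
  simp only [bad_consWord_consWord, not_true_eq_false, not_false_eq_true, true_and, false_and,
    or_false, h]
  change count0 n + countLate n + (countLate n + countLate n) = _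
  ring

theorem count_one : count0 1 = 1 ∧ count1 1 = 1 ∧ count2 1 = 1 ∧ countLate 1 = 1 := by
  have h : ∀ m b, m ≤ 4 → ¬ HasTrigger m b := by
    rintro m b hm ⟨e, -, -, -, h⟩
    omega
  exact ⟨wordCount_one _ fun b => h _ _ (by omega), wordCount_one _ fun b => h _ _ (by omega),
    wordCount_one _ fun b => h _ _ (by omega),
    wordCount_one _ fun b hb => h 1 b (by omega) hb.hasTrigger⟩

theorem countTail_one : countTail 1 = 1 :=
  wordCount_one _ fun b => by omega

theorem countTail_two : countTail 2 = 1 := by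
  rw [countTail, wordCount_succ le_rfl, wordCount_eq_zero, wordCount_one]
  · simp
  · simp

theorem countTail_of_three_le {n : ℕ} (hn : 3 ≤ n) : countTail n = 0 :=
  wordCount_eq_zero _ _ fun b => by simp [hn]

theorem counts_eq_fib (k : ℕ) :
    count2 (k + 3) = 3 ∧
    count1 (k + 3) = Nat.fib (k + 4) + Nat.fib (k + 2) ∧
    count0 (k + 3) + 3 = Nat.fib (k + 5) + Nat.fib (k + 3) ∧
    countLate (k + 3) + 3 * k + 7 = Nat.fib (k + 6) + Nat.fib (k + 4) := by
  induction k with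
  | zero =>
    obtain ⟨h0, h1, h2, hL⟩ := count_one
    have a0 := count0_succ (n := 1) le_rfl
    have a1 := count1_succ (n := 1) le_rfl
    have a2 := count2_succ (n := 1) le_rfl
    have aL := countLate_succ (n := 1) le_rfl
    have b0 := count0_succ (n := 2) (by omega)
    have b1 := count1_succ (n := 2) (by omega)
    have b2 := count2_succ (n := 2) (by omega)
    have bL := countLate_succ (n := 2) (by omega)
    rw [countTail_one] at a2
    rw [countTail_two] at b2
    norm_num [Nat.fib_add_two] at *
    omega
  | succ k ih =>
    obtain ⟨h2, h1, h0, hL⟩ := ih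
    have b0 := count0_succ (n := k + 3) (by omega)
    have b1 := count1_succ (n := k + 3) (by omega)
    have b2 := count2_succ (n := k + 3) (by omega)
    have bL := countLate_succ (n := k + 3) (by omega)
    rw [countTail_of_three_le (by omega)] at b2
    have f4 : Nat.fib (k + 4) = Nat.fib (k + 2) + Nat.fib (k + 3) := Nat.fib_add_two
    have f5 : Nat.fib (k + 5) = Nat.fib (k + 3) + Nat.fib (k + 4) := Nat.fib_add_two
    have f6 : Nat.fib (k + 6) = Nat.fib (k + 4) + Nat.fib (k + 5) := Nat.fib_add_two
    have f7 : Nat.fib (k + 7) = Nat.fib (k + 5) + Nat.fib (k + 6) := Nat.fib_add_two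
    simp only [show k + 1 + 2 = k + 3 by omega, show k + 1 + 3 = k + 3 + 1 by omega,
      show k + 1 + 4 = k + 5 by omega, show k + 1 + 5 = k + 6 by omega,
      show k + 1 + 6 = k + 7 by omega]
    have e4 : Nat.fib (k + 3 + 1) = Nat.fib (k + 4) := rfl
    omega

/-- For `n ≥ 5`, `|S_n(132, 123, γ_{2,2,2})| = 5 F_{n+1} - 9n + 21`. -/
theorem statement10 (n : ℕ) (hn : 5 ≤ n) :
    (Nat.card {π : Equiv.Perm (Fin n) //
        PAvoids π p132 ∧ PAvoids π p123 ∧ PAvoids π g222} : ℤ) =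
      5 * Nat.fib (n + 1) - 9 * n + 21 := by
  have hcard : Nat.card {π : Equiv.Perm (Fin n) //
      PAvoids π p132 ∧ PAvoids π p123 ∧ PAvoids π g222} = wordCount n fun b => ¬ Bad n b := by
    refine Nat.card_congr (Equiv.subtypeEquivRight fun π => ?_)
    rw [← and_assoc, ← atMostOneLarger_iff]
    exact and_congr_right fun h => not_congr h.pContains_g222_iff
  obtain ⟨k, rfl⟩ : ∃ k, n = k + 3 + 2 := ⟨n - 5, by omega⟩
  rw [hcard, wordCount_bad (by omega)]
  obtain ⟨-, -, h0, hL⟩ := counts_eq_fib k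
  have f5 : Nat.fib (k + 5) = Nat.fib (k + 3) + Nat.fib (k + 4) := Nat.fib_add_two
  have f6 : Nat.fib (k + 6) = Nat.fib (k + 4) + Nat.fib (k + 5) := Nat.fib_add_two
  have e6 : Nat.fib (k + 3 + 2 + 1) = Nat.fib (k + 6) := rfl
  rw [e6]
  push_cast
  omega
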